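/- arXiv:1802.09487 — 2 statements merged into one kernel-verified Lean document; each statement's English description precedes it below -/
import Mathlib

section
/- Gaussian ratio bound (analytic core of Lemma 4.5): Let K > 1, ε ∈ (0, 1/2), δ > 1, and 0 < c_g ≤ C_g < ∞. Then there exist d > 0 and N ∈ ℕ such that for every integer n ≥ N, every ρ ∈ [2/C_g, 2/c_g], and every real V with V ≤ δ·2^{−(1−ε)n}, one has P(Z ≤ −ρ·(2^{−2εn} + 2^{(1−2ε)n}·V)) ≥ d · P(Z ≤ −ρ·(−2^{−2εn}·(K+1) + 2^{(1−2ε)n}·V)), where Z is a standard normal random variable. -/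
open MeasureTheory ProbabilityTheory

/-- Gaussian ratio bound (analytic core of Lemma 4.5): for large enough `n`,
uniformly over `ρ ∈ [2/C_g, 2/c_g]` and `V ≤ δ·2^{-(1-ε)n}`,
`P(Z ≤ -ρ(2^{-2εn} + 2^{(1-2ε)n} V)) ≥ d · P(Z ≤ -ρ(-2^{-2εn}(K+1) + 2^{(1-2ε)n} V))`. -/
theorem stmt1 (K ε δ cg Cg : ℝ)
    (hK : 1 < K) (hε0 : 0 < ε) (hε1 : ε < 1 / 2) (hδ : 1 < δ)
    (hcg : 0 < cg) (hcC : cg ≤ Cg) :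
    ∃ d > (0 : ℝ), ∃ N : ℕ, ∀ n : ℕ, N ≤ n → ∀ ρ ∈ Set.Icc (2 / Cg) (2 / cg),
      ∀ V : ℝ, V ≤ δ * 2 ^ (-(1 - ε) * (n : ℝ)) →
      d * (gaussianReal 0 1 (Set.Iic
            (-ρ * (-(2 : ℝ) ^ (-2 * ε * (n : ℝ)) * (K + 1)
              + (2 : ℝ) ^ ((1 - 2 * ε) * (n : ℝ)) * V)))).toReal
        ≤ (gaussianReal 0 1 (Set.Iic
            (-ρ * ((2 : ℝ) ^ (-2 * ε * (n : ℝ))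
              + (2 : ℝ) ^ ((1 - 2 * ε) * (n : ℝ)) * V)))).toReal := by
  have hd : gaussianReal 0 1 (Set.Iic (-(2 / cg * (1 + δ)))) ≠ 0 := by
    intro h
    have h2 := gaussianReal_absolutelyContinuous' 0 (v := 1) one_ne_zero h
    simp at h2
  refine ⟨(gaussianReal 0 1 (Set.Iic (-(2 / cg * (1 + δ))))).toReal,
    ENNReal.toReal_pos hd (measure_ne_top _ _), 0, ?_⟩
  intro n _ ρ hρ V hV
  have hρ0 : 0 < ρ := lt_of_lt_of_le (by have := hcg.trans_le hcC; positivity) hρ.1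
  have h1 : (gaussianReal 0 1 (Set.Iic
            (-ρ * (-(2 : ℝ) ^ (-2 * ε * (n : ℝ)) * (K + 1)
              + (2 : ℝ) ^ ((1 - 2 * ε) * (n : ℝ)) * V)))).toReal ≤ 1 :=
    ENNReal.toReal_le_of_le_ofReal zero_le_one (by simpa using prob_le_one)
  refine (mul_le_of_le_one_right ENNReal.toReal_nonneg h1).trans ?_
  refine ENNReal.toReal_mono (measure_ne_top _ _) (measure_mono (Set.Iic_subset_Iic.2 ?_))
  have hn : (0 : ℝ) ≤ n := Nat.cast_nonneg n
  have hu : (2 : ℝ) ^ (-2 * ε * (n : ℝ)) ≤ 1 :=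
    Real.rpow_le_one_of_one_le_of_nonpos one_le_two (by nlinarith [mul_nonneg hε0.le hn])
  have hs : (2 : ℝ) ^ (-ε * (n : ℝ)) ≤ 1 :=
    Real.rpow_le_one_of_one_le_of_nonpos one_le_two (by nlinarith [mul_nonneg hε0.le hn])
  have hW : (2 : ℝ) ^ ((1 - 2 * ε) * (n : ℝ)) * V ≤ δ := by
    calc (2 : ℝ) ^ ((1 - 2 * ε) * (n : ℝ)) * V
        ≤ (2 : ℝ) ^ ((1 - 2 * ε) * (n : ℝ)) * (δ * 2 ^ (-(1 - ε) * (n : ℝ))) := by gcongr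
      _ = δ * (2 : ℝ) ^ (-ε * (n : ℝ)) := by
          rw [mul_left_comm, ← Real.rpow_add two_pos]
          ring_nf
      _ ≤ δ := mul_le_of_le_one_right (by linarith) hs
  have h3 : ρ * ((2 : ℝ) ^ (-2 * ε * (n : ℝ)) + (2 : ℝ) ^ ((1 - 2 * ε) * (n : ℝ)) * V)
      ≤ ρ * (1 + δ) := mul_le_mul_of_nonneg_left (add_le_add hu hW) hρ0.le
  have h4 : ρ * (1 + δ) ≤ 2 / cg * (1 + δ) :=
    mul_le_mul_of_nonneg_right hρ.2 (by linarith)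
  rw [neg_mul]
  linarith
end

section
/- Gaussian tail ratio inequality (Lemma 8 of Mueller–Pardoux, used in the proof of Lemma 4.5): Let Z be a standard normal random variable and let a, b > 0. Then P(Z > a)/P(Z > a+b) ≤ max( 1/(2·P(Z > 1)), 1 + (√e/(1−e^{−1}))·(a+b)·b·e^{ab + b²/2} ). -/
open MeasureTheory ProbabilityTheory

lemma gmass_Ioc (u v : ℝ) (h : u ≤ v) :
    (gaussianReal 0 1 (Set.Ioc u v)).toReal = ∫ x in u..v, gaussianPDFReal 0 1 x := by
  rw [gaussianReal_apply_eq_integral 0 (by norm_num), ENNReal.toReal_ofReal,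
    intervalIntegral.integral_of_le h]
  exact integral_nonneg fun x => gaussianPDFReal_nonneg 0 1 x

lemma gpdf_eq (x : ℝ) :
    gaussianPDFReal 0 1 x = (Real.sqrt (2 * Real.pi))⁻¹ * Real.exp (-x ^ 2 / 2) := by
  simp [gaussianPDFReal]

lemma gpdf_cont : Continuous (gaussianPDFReal 0 1) := by
  have : gaussianPDFReal 0 1 =
      fun x => (Real.sqrt (2 * Real.pi))⁻¹ * Real.exp (-x ^ 2 / 2) := funext gpdf_eq
  rw [this]; fun_prop

lemma gtail_half (a : ℝ) (ha : 0 < a) : (gaussianReal 0 1 (Set.Ioi a)).toReal ≤ 1 / 2 := by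
  have h1 : gaussianReal 0 1 (Set.Iio (-a)) = gaussianReal 0 1 (Set.Ioi a) := by
    have h := gaussianReal_map_neg (μ := 0) (v := 1)
    rw [neg_zero] at h
    conv_lhs => rw [← h]
    rw [Measure.map_apply measurable_neg measurableSet_Iio]
    congr 1
    ext x; simp
  have hd : Disjoint (Set.Iio (-a)) (Set.Ioi a) := by
    rw [Set.disjoint_left]; intro x hx hx'
    simp only [Set.mem_Iio, Set.mem_Ioi] at hx hx'
    linarith
  have h2 := measureReal_union (μ := gaussianReal 0 1) hd measurableSet_Ioi
  have h3 : (gaussianReal 0 1).real (Set.Iio (-a) ∪ Set.Ioi a) ≤ 1 := measureReal_le_one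
  simp only [Measure.real, h1] at h2 h3
  linarith

lemma gtail_lower (c : ℝ) (hc : 1 ≤ c) :
    gaussianPDFReal 0 1 c * Real.exp (-(1 / 2)) * ((1 - Real.exp (-1)) / c) ≤
      (gaussianReal 0 1 (Set.Ioi c)).toReal := by
  have c0 : 0 < c := by linarith
  have hi : 0 < 1 / c := by positivity
  have hi1 : 1 / c ≤ 1 := by rw [div_le_one c0]; exact hc
  calc _ = ∫ x in c..(c + 1 / c),
        gaussianPDFReal 0 1 c * Real.exp (-(1 / 2)) * Real.exp (-(c * (x - c))) := by
        rw [intervalIntegral.integral_const_mul]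
        congr 1
        rw [intervalIntegral.integral_eq_sub_of_hasDerivAt
          (f := fun x => -(Real.exp (-(c * (x - c))) / c))]
        · have : c * (c + 1 / c - c) = 1 := by field_simp; ring
          rw [this]; simp; ring
        · intro x _
          have h : HasDerivAt (fun x : ℝ => -(c * (x - c))) (-(c * 1)) x :=
            (((hasDerivAt_id x).sub_const c).const_mul c).neg
          have := (h.exp.div_const c).neg
          convert this using 1
          · rfl
          · field_simp
        · apply Continuous.intervalIntegrable; fun_prop
    _ ≤ ∫ x in c..(c + 1 / c), gaussianPDFReal 0 1 x := by
        apply intervalIntegral.integral_mono_on (by linarith)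
        · apply Continuous.intervalIntegrable; fun_prop
        · exact gpdf_cont.intervalIntegrable _ _
        · intro x hx
          rw [gpdf_eq, gpdf_eq, mul_assoc, mul_assoc, ← Real.exp_add, ← Real.exp_add]
          gcongr
          obtain ⟨h1, h2⟩ := hx
          nlinarith
    _ = (gaussianReal 0 1 (Set.Ioc c (c + 1 / c))).toReal := (gmass_Ioc _ _ (by linarith)).symm
    _ ≤ _ := ENNReal.toReal_mono (measure_ne_top _ _) (measure_mono Set.Ioc_subset_Ioi_self)

lemma gtail_upper (a b : ℝ) (ha : 0 < a) (hb : 0 < b) :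
    (gaussianReal 0 1 (Set.Ioi a)).toReal ≤
      (gaussianReal 0 1 (Set.Ioi (a + b))).toReal + b * gaussianPDFReal 0 1 a := by
  have hd : Disjoint (Set.Ioc a (a + b)) (Set.Ioi (a + b)) := by
    rw [Set.disjoint_left]; intro x hx hx'
    exact absurd hx.2 (not_le.2 hx')
  have h2 := measureReal_union (μ := gaussianReal 0 1) hd measurableSet_Ioi
  rw [Set.Ioc_union_Ioi_eq_Ioi (by linarith)] at h2
  simp only [Measure.real] at h2
  rw [h2, gmass_Ioc _ _ (by linarith)]
  have : ∫ x in a..(a + b), gaussianPDFReal 0 1 x ≤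
      ∫ x in a..(a + b), gaussianPDFReal 0 1 a := by
    apply intervalIntegral.integral_mono_on (by linarith)
    · exact gpdf_cont.intervalIntegrable _ _
    · apply Continuous.intervalIntegrable; fun_prop
    · intro x hx
      rw [gpdf_eq, gpdf_eq]
      gcongr
      exact hx.1
  rw [intervalIntegral.integral_const, smul_eq_mul, add_sub_cancel_left] at this
  linarith

/-- Gaussian tail ratio inequality (Lemma 8 of Mueller–Pardoux, used in the
proof of Lemma 4.5): for a standard normal `Z` and `a, b > 0`,
`P(Z > a)/P(Z > a+b) ≤ max(1/(2P(Z > 1)), 1 + (√e/(1-e⁻¹))(a+b)b·e^{ab+b²/2})`. -/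
theorem stmt14 (a b : ℝ) (ha : 0 < a) (hb : 0 < b) :
    (gaussianReal 0 1 (Set.Ioi a)).toReal / (gaussianReal 0 1 (Set.Ioi (a + b))).toReal ≤
      max (1 / (2 * (gaussianReal 0 1 (Set.Ioi (1 : ℝ))).toReal))
        (1 + Real.sqrt (Real.exp 1) / (1 - Real.exp (-1)) * (a + b) * b *
          Real.exp (a * b + b ^ 2 / 2)) := by
  have he : 0 < 1 - Real.exp (-1) := by
    have : Real.exp (-1) < 1 := by simp
    linarith
  have pos : ∀ c : ℝ, 1 ≤ c → 0 < (gaussianReal 0 1 (Set.Ioi c)).toReal := by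
    intro c hc
    refine lt_of_lt_of_le ?_ (gtail_lower c hc)
    have := gaussianPDFReal_pos 0 1 c (by norm_num)
    have c0 : 0 < c := by linarith
    positivity
  rcases le_total (a + b) 1 with h | h
  · apply le_max_of_le_left
    have h1 : (gaussianReal 0 1 (Set.Ioi (1 : ℝ))).toReal ≤
        (gaussianReal 0 1 (Set.Ioi (a + b))).toReal :=
      ENNReal.toReal_mono (measure_ne_top _ _) (measure_mono (Set.Ioi_subset_Ioi h))
    rw [← div_div]
    exact div_le_div₀ (by norm_num) (gtail_half a ha) (pos 1 le_rfl) h1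
  · apply le_max_of_le_right
    have hp := pos _ h
    have hl := gtail_lower _ h
    have hu := gtail_upper a b ha hb
    have c0 : 0 < a + b := by linarith
    rw [div_le_iff₀ hp, add_mul, one_mul]
    refine hu.trans (add_le_add_right ?_ _)
    have hs : Real.sqrt (Real.exp 1) = Real.exp (1 / 2) := by
      rw [Real.exp_half]
    rw [hs]
    have hφ : gaussianPDFReal 0 1 a =
        gaussianPDFReal 0 1 (a + b) * Real.exp (-(1 / 2)) * Real.exp (1 / 2) *
          Real.exp (a * b + b ^ 2 / 2) := by
      rw [gpdf_eq, gpdf_eq]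
      simp only [mul_assoc, ← Real.exp_add]
      congr 2; ring
    calc b * gaussianPDFReal 0 1 a = Real.exp (1 / 2) / (1 - Real.exp (-1)) * (a + b) * b *
          Real.exp (a * b + b ^ 2 / 2) * (gaussianPDFReal 0 1 (a + b) * Real.exp (-(1 / 2)) *
            ((1 - Real.exp (-1)) / (a + b))) := by
          rw [hφ]; field_simp
      _ ≤ _ := mul_le_mul_of_nonneg_left hl (by positivity)
end
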